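/- Let λ be an infinite cardinal and let X be a Hausdorff topological space that is λ⁺-additive, i.e., the intersection of any family of at most λ open subsets of X is open. Then for every subset S ⊆ X and every point q ∈ X, the point q is an accumulation point of S (that is, q lies in the closure of S \ {q}) if and only if every open neighborhood U of q satisfies |U ∩ S| > λ. (This is the purely topological core of Proposition 2.9: under χ-tameness, a Galois type q ∈ X_M^λ is an accumulation point of a set S of types if and only if every neighborhood of q contains more than λ members of S.) -/

import Mathlib

universe u

/-- If `X` is a Hausdorff space that is `λ⁺`-additive (the intersection of any
family of at most `λ` open sets is open), where `λ` is an infinite cardinal, then for any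
`S ⊆ X` and `q ∈ X`, the point `q` is an accumulation point of `S` (i.e. `q ∈ closure (S \ {q})`)
iff every open neighborhood `U` of `q` satisfies `|U ∩ S| > λ`. -/
theorem accumulation_point_iff_of_additive
    (lam : Cardinal.{u}) (hlam : Cardinal.aleph0 ≤ lam)
    (X : Type u) [TopologicalSpace X] [T2Space X]
    (hadd : ∀ (ι : Type u) (U : ι → Set X),
      Cardinal.mk ι ≤ lam → (∀ i, IsOpen (U i)) → IsOpen (⋂ i, U i))
    (S : Set X) (q : X) :
    q ∈ closure (S \ {q}) ↔
      ∀ U : Set X, IsOpen U → q ∈ U → lam < Cardinal.mk ↥(U ∩ S) := by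
  rw [mem_closure_iff]
  constructor
  · intro h U hU hqU
    by_contra! hcard
    have hopen : IsOpen (⋂ x : ↥((U ∩ S) \ {q}), ({(x : X)}ᶜ : Set X)) :=
      hadd _ _ ((Cardinal.mk_le_mk_of_subset Set.sdiff_subset).trans hcard)
        fun _ => isOpen_compl_singleton
    obtain ⟨x, ⟨hxU, hx⟩, hxS, hxq⟩ := h _ (hU.inter hopen)
      ⟨hqU, Set.mem_iInter.2 fun x hqx => x.2.2 hqx.symm⟩
    exact Set.mem_iInter.1 hx ⟨x, ⟨hxU, hxS⟩, hxq⟩ rfl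
  · intro h U hU hqU
    by_contra hempty
    have hsub : U ∩ S ⊆ {q} := fun x hx => by
      by_contra hxq
      exact hempty ⟨x, hx.1, hx.2, hxq⟩
    have hle : Cardinal.mk ↥(U ∩ S) ≤ 1 :=
      (Cardinal.mk_le_mk_of_subset hsub).trans_eq (Cardinal.mk_singleton q)
    exact (h U hU hqU).not_ge (hle.trans (Cardinal.one_le_aleph0.trans hlam))
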